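/- arXiv:1205.1223 — 5 statements merged into one kernel-verified Lean document; each statement's English description precedes it below -/
import Mathlib

section
/- Let f, g ∈ ℝ[x₁,…,xₙ] be coprime polynomials and U ⊆ ℝⁿ a connected open set. Then the set V = U \ Zero(f,g), where Zero(f,g) denotes the set of common real zeros of f and g, is a connected open subset of ℝⁿ. -/
open MvPolynomial

/-- Elimination of the variable in a gcd domain. -/
theorem elim_aux {A : Type*} [CommRing A] [IsDomain A] [UniqueFactorizationMonoid A]
    (F G : Polynomial A) (h : IsRelPrime F G) :
    ∃ (a b : Polynomial A) (c : A), c ≠ 0 ∧ a * F + b * G = Polynomial.C c := by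
  classical
  let K := FractionRing A
  have : NormalizedGCDMonoid A := Nonempty.some inferInstance
  have hinj : Function.Injective (Polynomial.map (algebraMap A K)) :=
    Polynomial.map_injective _ (IsFractionRing.injective A K)
  have hrel : IsRelPrime (F.map (algebraMap A K)) (G.map (algebraMap A K)) := by
    intro D hF hG
    have hD : D ≠ 0 := by
      rintro rfl
      have h1 : F = 0 := hinj (by simpa using zero_dvd_iff.1 hF)
      have h2 : G = 0 := hinj (by simpa using zero_dvd_iff.1 hG)
      subst h1 h2
      exact not_isUnit_zero (h (dvd_refl _) (dvd_refl _))
    apply Polynomial.isUnit_or_eq_zero_of_isUnit_integerNormalization_primPart (R := A) hD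
    obtain ⟨c, c0, hc⟩ := IsLocalization.integerNormalization_spec (nonZeroDivisors A) D
    have hdvd : (IsLocalization.integerNormalization (nonZeroDivisors A) D).primPart.map
        (algebraMap A K) ∣ D := by
      have h1 : (IsLocalization.integerNormalization (nonZeroDivisors A) D).primPart.map
        (algebraMap A K) ∣ c • D := by
        rw [← hc]
        exact Polynomial.map_dvd _ (Polynomial.primPart_dvd _)
      have hu : IsUnit (Polynomial.C (algebraMap A K c)) := by
        rw [Polynomial.isUnit_C, isUnit_iff_ne_zero]
        simpa using nonZeroDivisors.ne_zero c0
      rw [Algebra.smul_def, Polynomial.algebraMap_apply] at h1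
      exact (hu.dvd_mul_left).1 h1
    have hp := (Polynomial.isPrimitive_primPart
      (IsLocalization.integerNormalization (nonZeroDivisors A) D))
    exact h (hp.dvd_of_fraction_map_dvd_fraction_map (hdvd.trans hF))
      (hp.dvd_of_fraction_map_dvd_fraction_map (hdvd.trans hG))
  obtain ⟨u, v, huv⟩ := hrel.isCoprime
  obtain ⟨c, c0, hc⟩ := IsLocalization.integerNormalization_spec (nonZeroDivisors A) u
  obtain ⟨d, d0, hd⟩ := IsLocalization.integerNormalization_spec (nonZeroDivisors A) v
  refine ⟨Polynomial.C d * IsLocalization.integerNormalization (nonZeroDivisors A) u,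
    Polynomial.C c * IsLocalization.integerNormalization (nonZeroDivisors A) v, c * d,
    mul_ne_zero (nonZeroDivisors.ne_zero c0) (nonZeroDivisors.ne_zero d0), hinj ?_⟩
  rw [Algebra.smul_def, Polynomial.algebraMap_apply] at hc hd
  simp only [Polynomial.map_add, Polynomial.map_mul, hc, hd, Polynomial.map_C, map_mul]
  change Polynomial.C (algebraMap A K d) * (Polynomial.C (algebraMap A K c) * u) * _ +
    Polynomial.C (algebraMap A K c) * (Polynomial.C (algebraMap A K d) * v) * _ = _
  linear_combination (Polynomial.C (algebraMap A K c) * Polynomial.C (algebraMap A K d)) * huv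

theorem elim_var {n : ℕ} (f g : MvPolynomial (Fin n) ℝ) (hfg : IsRelPrime f g) (k : Fin n) :
    ∃ h : MvPolynomial (Fin n) ℝ, h ≠ 0 ∧ ∀ x y : Fin n → ℝ, (∀ i, i ≠ k → x i = y i) →
      eval y f = 0 → eval y g = 0 → eval x h = 0 := by
  classical
  let e : MvPolynomial (Fin n) ℝ ≃ₐ[ℝ] Polynomial (MvPolynomial {i // i ≠ k} ℝ) :=
    (renameEquiv ℝ (Equiv.optionSubtypeNe k).symm).trans (optionEquivLeft ℝ _)
  have hrel : IsRelPrime (e f) (e g) := by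
    intro d hd1 hd2
    have h1 : e.symm d ∣ f := by simpa using map_dvd e.symm hd1
    have h2 : e.symm d ∣ g := by simpa using map_dvd e.symm hd2
    simpa using (hfg h1 h2).map e
  obtain ⟨a, b, c, hc, habc⟩ := elim_aux _ _ hrel
  have key : ∀ p : MvPolynomial {i // i ≠ k} ℝ, e (rename Subtype.val p) = Polynomial.C p := by
    intro p
    induction p using MvPolynomial.induction_on with
    | C a => simp [e]
    | add p q hp hq => simp [hp, hq]
    | mul_X p i hp =>
      simp only [map_mul, hp, rename_X]
      simp [e, Equiv.optionSubtypeNe_symm_of_ne i.2]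
  refine ⟨rename Subtype.val c, ?_, ?_⟩
  · intro h0
    exact hc (rename_injective _ Subtype.val_injective (by simpa using h0))
  · intro x y hxy hf hg
    have h1 : e.symm a * f + e.symm b * g = rename Subtype.val c := by
      apply e.injective
      simp [key, habc]
    have h2 : eval x (rename Subtype.val c) = eval y (rename Subtype.val c) := by
      rw [eval_rename, eval_rename]
      congr 2
      funext i
      exact hxy i i.2
    rw [h2, ← h1]
    simp [hf, hg]

theorem exists_ne_box {σ : Type*} (p : MvPolynomial σ ℝ) (hp : p ≠ 0)
    (c : σ → ℝ) {r : ℝ} (hr : 0 < r) :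
    ∃ x : σ → ℝ, (∀ i, dist (x i) (c i) < r) ∧ eval x p ≠ 0 := by
  by_contra! hcon
  apply hp
  refine funext_set (fun i => Metric.ball (c i) r) (fun i => ?_) (fun x hx => ?_)
  · rw [Real.ball_eq_Ioo]
    exact Set.Ioo_infinite (by linarith)
  · rw [map_zero]
    exact hcon x (fun i => hx i trivial)

theorem dense_aux {n : ℕ} (f g : MvPolynomial (Fin n) ℝ) (hfg : IsRelPrime f g)
    (W : Set (Fin n → ℝ)) (hW : IsOpen W) (hne : W.Nonempty) :
    (W \ {a | eval a f = 0 ∧ eval a g = 0}).Nonempty := by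
  obtain ⟨c, hc⟩ := hne
  obtain ⟨r, hr, hb⟩ := Metric.isOpen_iff.1 hW c hc
  by_cases hf : f = 0
  · have hg : g ≠ 0 := by
      rintro rfl
      subst hf
      exact not_isUnit_zero (hfg (dvd_refl _) (dvd_refl _))
    obtain ⟨x, hx, hx'⟩ := exists_ne_box g hg c hr
    exact ⟨x, hb ((dist_pi_lt_iff hr).2 hx), fun h => hx' h.2⟩
  · obtain ⟨x, hx, hx'⟩ := exists_ne_box f hf c hr
    exact ⟨x, hb ((dist_pi_lt_iff hr).2 hx), fun h => hx' h.1⟩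

theorem isClosed_aux {n : ℕ} (f g : MvPolynomial (Fin n) ℝ) :
    IsClosed {a | eval a f = 0 ∧ eval a g = 0} :=
  (isClosed_eq f.continuous_eval continuous_const).inter
    (isClosed_eq g.continuous_eval continuous_const)

theorem ball_aux {n : ℕ} (f g : MvPolynomial (Fin n) ℝ) (hfg : IsRelPrime f g)
    (c : Fin n → ℝ) (r : ℝ) :
    IsPreconnected (Metric.ball c r \ {a | eval a f = 0 ∧ eval a g = 0}) := by
  classical
  set Z := {a : Fin n → ℝ | eval a f = 0 ∧ eval a g = 0} with hZ
  have hZc : IsClosed Z := isClosed_aux f g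
  rintro u v hu hv huv ⟨p, hpB, hpu⟩ ⟨q, hqB, hqv⟩
  have hBo : IsOpen (Metric.ball c r \ Z) := Metric.isOpen_ball.sdiff hZc
  obtain ⟨ε, hε, hPb⟩ := Metric.isOpen_iff.1 (hBo.inter hu) p ⟨hpB, hpu⟩
  obtain ⟨δ, hδ, hQb⟩ := Metric.isOpen_iff.1 (hBo.inter hv) q ⟨hqB, hqv⟩
  have hr : 0 < r := dist_nonneg.trans_lt hpB.1
  choose h h0 hh using elim_var f g hfg
  -- generic choice
  let s : Fin n → Fin n → Fin n ⊕ Fin n := fun k i => if i < k then Sum.inr i else Sum.inl i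
  have hs : ∀ k, Function.Injective (s k) := by
    intro k i j hij
    simp only [s] at hij
    split_ifs at hij <;> simp_all
  have hne : (∏ k, rename (s k) (h k)) ≠ 0 := by
    rw [Finset.prod_ne_zero_iff]
    intro k _ hk
    exact h0 k (rename_injective _ (hs k) (by simpa using hk))
  obtain ⟨x, hx, hxne⟩ := exists_ne_box _ hne (Sum.elim p q) (lt_min hε hδ)
  rw [map_prod, Finset.prod_ne_zero_iff] at hxne
  set p' : Fin n → ℝ := fun i => x (Sum.inl i) with hp'
  set q' : Fin n → ℝ := fun i => x (Sum.inr i) with hq'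
  have hpP := hPb ((dist_pi_lt_iff hε).2
    (fun i => (hx (Sum.inl i)).trans_le (min_le_left _ _)) : p' ∈ Metric.ball p ε)
  have hqQ := hQb ((dist_pi_lt_iff hδ).2
    (fun i => (hx (Sum.inr i)).trans_le (min_le_right _ _)) : q' ∈ Metric.ball q δ)
  let m : ℕ → Fin n → ℝ := fun k i => if (i : ℕ) < k then q' i else p' i
  have hmB : ∀ k, m k ∈ Metric.ball c r := by
    intro k
    refine (dist_pi_lt_iff hr).2 (fun i => ?_)
    simp only [m]
    split_ifs
    · exact (dist_pi_lt_iff hr).1 hqQ.1.1 i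
    · exact (dist_pi_lt_iff hr).1 hpP.1.1 i
  have hm0 : m 0 = p' := by funext i; simp [m]
  have hmn : m n = q' := by funext i; simp [m]
  have hstep : ∀ k : ℕ, k ≤ n → JoinedIn (Metric.ball c r \ Z) p' (m k) := by
    intro k
    induction k with
    | zero => intro _; rw [hm0]; exact JoinedIn.refl hpP.1
    | succ k ih =>
      intro hk
      refine (ih (by omega)).trans (JoinedIn.of_segment_subset ?_)
      intro y hy
      refine ⟨(convex_ball c r).segment_subset (hmB k) (hmB (k+1)) hy, ?_⟩
      rintro ⟨hyf, hyg⟩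
      let k' : Fin n := ⟨k, hk⟩
      apply hxne k' (Finset.mem_univ _)
      rw [eval_rename]
      have hxs : x ∘ s k' = m k := by
        funext i
        simp only [Function.comp, s, m, k', Fin.lt_def]
        split_ifs <;> rfl
      rw [hxs]
      refine hh k' _ y (fun i hi => ?_) hyf hyg
      have hmi : m (k+1) i = m k i := by
        have : (i : ℕ) ≠ k := fun h => hi (Fin.ext h)
        simp only [m]
        have : (i : ℕ) < k + 1 ↔ (i : ℕ) < k := by omega
        simp [this]
      obtain ⟨a, b, ha, hb, hab, rfl⟩ := hy
      simp only [Pi.add_apply, Pi.smul_apply, smul_eq_mul, hmi]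
      rw [← add_mul, hab, one_mul]
  have hJ := hstep n le_rfl
  rw [hmn] at hJ
  obtain ⟨γ, hγ⟩ := hJ
  have hsub : Set.range γ ⊆ Metric.ball c r \ Z := by rintro _ ⟨t, rfl⟩; exact hγ t
  obtain ⟨z, hz, hz'⟩ := (isPreconnected_range γ.continuous) u v hu hv (hsub.trans huv)
    ⟨p', ⟨0, γ.source⟩, hpP.2⟩ ⟨q', ⟨1, γ.target⟩, hqQ.2⟩
  exact ⟨z, hsub hz, hz'⟩

theorem stmt_7 (n : ℕ) (f g : MvPolynomial (Fin n) ℝ) (hfg : IsRelPrime f g)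
    (U : Set (Fin n → ℝ)) (hUopen : IsOpen U) (hUconn : IsConnected U) :
    IsOpen (U \ {a | MvPolynomial.eval a f = 0 ∧ MvPolynomial.eval a g = 0}) ∧
    IsConnected (U \ {a | MvPolynomial.eval a f = 0 ∧ MvPolynomial.eval a g = 0}) := by
  refine ⟨hUopen.sdiff (isClosed_aux f g), dense_aux f g hfg U hUopen hUconn.nonempty, ?_⟩
  set Z := {a : Fin n → ℝ | eval a f = 0 ∧ eval a g = 0} with hZ
  rintro u v hu hv huv ⟨p, hpS, hpu⟩ ⟨q, hqS, hqv⟩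
  by_contra hcon
  let N : Set (Fin n → ℝ) → Set (Fin n → ℝ) :=
    fun w => ⋃₀ {W | IsOpen W ∧ W ⊆ U ∧ W \ Z ⊆ w}
  have hN : ∀ w, IsOpen (N w) := fun w => isOpen_sUnion (fun W hW => hW.1)
  have hS : IsOpen (U \ Z) := hUopen.sdiff (isClosed_aux f g)
  have hcov : U ⊆ N u ∪ N v := by
    intro x hx
    obtain ⟨r, hr, hb⟩ := Metric.isOpen_iff.1 hUopen x hx
    have hsub : Metric.ball x r \ Z ⊆ U \ Z := Set.diff_subset_diff_left hb
    by_cases h1 : Metric.ball x r \ Z ⊆ u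
    · exact Or.inl ⟨_, ⟨Metric.isOpen_ball, hb, h1⟩, Metric.mem_ball_self hr⟩
    · refine Or.inr ⟨_, ⟨Metric.isOpen_ball, hb, ?_⟩, Metric.mem_ball_self hr⟩
      intro y hy
      obtain ⟨z, hz, hzu⟩ := Set.not_subset.1 h1
      by_contra hyv
      have hyu := (huv (hsub hy)).resolve_right hyv
      have hzv := (huv (hsub hz)).resolve_left hzu
      obtain ⟨t, ht, ht'⟩ := ball_aux f g hfg x r u v hu hv (hsub.trans huv)
        ⟨y, hy, hyu⟩ ⟨z, hz, hzv⟩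
      exact hcon ⟨t, hsub ht, ht'⟩
  obtain ⟨x, hxU, ⟨W, hW, hxW⟩, ⟨W', hW', hxW'⟩⟩ := hUconn.isPreconnected (N u) (N v)
    (hN u) (hN v) hcov
    ⟨p, hpS.1, _, ⟨hS.inter hu, fun y hy => hy.1.1, fun y hy => hy.1.2⟩, hpS, hpu⟩
    ⟨q, hqS.1, _, ⟨hS.inter hv, fun y hy => hy.1.1, fun y hy => hy.1.2⟩, hqS, hqv⟩
  obtain ⟨y, ⟨hy1, hy2⟩, hyZ⟩ := dense_aux f g hfg (W ∩ W') (hW.1.inter hW'.1) ⟨x, hxW, hxW'⟩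
  exact hcon ⟨y, ⟨hW.2.1 hy1, hyZ⟩, hW.2.2 ⟨hy1, hyZ⟩, hW'.2.2 ⟨hy2, hyZ⟩⟩
end

section
/- Let U ⊆ ℝⁿ be a connected open set and f, g ∈ ℝ[x₁,…,xₙ] coprime polynomials with f(a)·g(a) ≥ 0 for all a ∈ U. Then either f(a) ≥ 0 and g(a) ≥ 0 for all a ∈ U, or f(a) ≤ 0 and g(a) ≤ 0 for all a ∈ U. -/
open MvPolynomial

section Helpers

open Polynomial in
theorem gauss_relPrime {R : Type*} [CommRing R] [IsDomain R] [UniqueFactorizationMonoid R]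
    (F G : Polynomial R) (hF : F ≠ 0) (h : IsRelPrime F G) :
    ∃ u v : Polynomial R, ∃ r : R, r ≠ 0 ∧ u * F + v * G = Polynomial.C r := by
  classical
  let K := FractionRing R
  letI : NormalizedGCDMonoid R := Nonempty.some inferInstance
  have inj : Function.Injective (algebraMap R K) := IsFractionRing.injective R K
  have hinj := Polynomial.map_injective (algebraMap R K) inj
  have hrel : IsRelPrime (F.map (algebraMap R K)) (G.map (algebraMap R K)) := by
    intro d hdF hdG
    have hd0 : d ≠ 0 := by
      rintro rfl
      rw [zero_dvd_iff] at hdF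
      exact hF (hinj (by simpa using hdF))
    obtain ⟨c, c0, hc⟩ :=
      IsLocalization.integerNormalization_spec (nonZeroDivisors R) d
    set q := IsLocalization.integerNormalization (nonZeroDivisors R) d with hq
    have hcK : algebraMap R K c ≠ 0 := by
      have := nonZeroDivisors.ne_zero c0
      simpa using fun h0 => this (inj (by simpa using h0))
    have key : ∀ H : Polynomial R, d ∣ H.map (algebraMap R K) → q.primPart ∣ H := by
      intro H hH
      apply q.isPrimitive_primPart.dvd_of_fraction_map_dvd_fraction_map (K := K)
      have h1 : q.primPart.map (algebraMap R K) ∣ q.map (algebraMap R K) :=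
        Polynomial.map_dvd _ q.primPart_dvd
      have h2 : c • d = Polynomial.C (algebraMap R K c) * d := by
        rw [Algebra.smul_def, Polynomial.algebraMap_apply]
      rw [hc, h2] at h1
      have hu : IsUnit (Polynomial.C (algebraMap R K c)) :=
        Polynomial.isUnit_C.mpr (isUnit_iff_ne_zero.mpr hcK)
      exact (h1.trans (hu.mul_left_dvd.mpr dvd_rfl)).trans hH
    exact isUnit_or_eq_zero_of_isUnit_integerNormalization_primPart hd0
      (h (key F hdF) (key G hdG))
  obtain ⟨u, v, huv⟩ := hrel.isCoprime
  obtain ⟨b, b0, hb⟩ := IsLocalization.integerNormalization_spec (nonZeroDivisors R) u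
  obtain ⟨c, c0, hc⟩ := IsLocalization.integerNormalization_spec (nonZeroDivisors R) v
  refine ⟨Polynomial.C c * IsLocalization.integerNormalization (nonZeroDivisors R) u,
    Polynomial.C b * IsLocalization.integerNormalization (nonZeroDivisors R) v, b * c,
    mul_ne_zero (nonZeroDivisors.ne_zero b0) (nonZeroDivisors.ne_zero c0), hinj ?_⟩
  simp only [Polynomial.map_add, Polynomial.map_mul, Polynomial.map_C, hb, hc, Algebra.smul_def,
    Polynomial.algebraMap_apply, map_mul]
  linear_combination (Polynomial.C (algebraMap R K b) * Polynomial.C (algebraMap R K c)) * huv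

/-- The substitution `x ↦ x + s v`, `s ↦ s` on `ℝ[x][s]`. -/
noncomputable def shiftHom {n : ℕ} (v : Fin n → ℝ) :
    Polynomial (MvPolynomial (Fin n) ℝ) →+* Polynomial (MvPolynomial (Fin n) ℝ) :=
  Polynomial.eval₂RingHom
    (MvPolynomial.aeval (R := ℝ) (fun i => Polynomial.C (X i) +
      Polynomial.C (C (v i)) * Polynomial.X)).toRingHom Polynomial.X

theorem shiftHom_comp {n : ℕ} (v w : Fin n → ℝ) (hvw : ∀ i, v i + w i = 0) :
    (shiftHom v).comp (shiftHom w) = RingHom.id _ := by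
  refine Polynomial.ringHom_ext' (MvPolynomial.ringHom_ext ?_ ?_) ?_
  · intro r
    simp [shiftHom, Polynomial.algebraMap_apply, MvPolynomial.algebraMap_eq]
  · intro i
    have h : w i = - v i := by linarith [hvw i]
    simp [shiftHom, Polynomial.algebraMap_apply, MvPolynomial.algebraMap_eq, h]
    ring
  · simp [shiftHom]

theorem shiftHom_eval {n : ℕ} (v x : Fin n → ℝ) (t : ℝ) (f : MvPolynomial (Fin n) ℝ) :
    Polynomial.eval₂ (MvPolynomial.eval x) t (shiftHom v (Polynomial.C f)) =
      MvPolynomial.eval (x + t • v) f := by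
  have : ((Polynomial.eval₂RingHom (MvPolynomial.eval x) t).comp
      ((shiftHom v).comp Polynomial.C)) = MvPolynomial.eval (x + t • v) := by
    refine MvPolynomial.ringHom_ext ?_ ?_
    · intro r
      simp [shiftHom, Polynomial.algebraMap_apply, MvPolynomial.algebraMap_eq]
    · intro i
      simp [shiftHom]
      ring
  exact congrArg (fun φ => φ f) this

theorem exists_line {n : ℕ} (f g : MvPolynomial (Fin n) ℝ) (hf : f ≠ 0) (hfg : IsRelPrime f g)
    (v : Fin n → ℝ) : ∃ r : MvPolynomial (Fin n) ℝ, r ≠ 0 ∧ ∀ (x : Fin n → ℝ) (t : ℝ),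
      MvPolynomial.eval (x + t • v) f = 0 → MvPolynomial.eval (x + t • v) g = 0 →
      MvPolynomial.eval x r = 0 := by
  have e1 := shiftHom_comp v (-v) (by simp)
  have e2 := shiftHom_comp (-v) v (by simp)
  have e1' : ∀ p, shiftHom v (shiftHom (-v) p) = p := fun p => congrArg (fun φ => φ p) e1
  have e2' : ∀ p, shiftHom (-v) (shiftHom v p) = p := fun p => congrArg (fun φ => φ p) e2
  have hF : shiftHom v (Polynomial.C f) ≠ 0 := by
    intro h
    have := e2' (Polynomial.C f)
    rw [h, map_zero] at this
    exact hf (by simpa using this.symm)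
  have hrel : IsRelPrime (shiftHom v (Polynomial.C f)) (shiftHom v (Polynomial.C g)) := by
    intro d hd1 hd2
    have h1 := map_dvd (shiftHom (-v)) hd1
    have h2 := map_dvd (shiftHom (-v)) hd2
    rw [e2'] at h1 h2
    have hdeg : (shiftHom (-v) d).natDegree = 0 := by
      have := Polynomial.natDegree_le_of_dvd h1 (by simpa using hf)
      simpa using this
    rw [Polynomial.eq_C_of_natDegree_eq_zero hdeg] at h1 h2
    have hu : IsUnit (shiftHom (-v) d) := by
      rw [Polynomial.eq_C_of_natDegree_eq_zero hdeg]
      refine Polynomial.isUnit_C.mpr (hfg ?_ ?_)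
      · simpa using Polynomial.C_dvd_iff_dvd_coeff _ _ |>.mp h1 0
      · simpa using Polynomial.C_dvd_iff_dvd_coeff _ _ |>.mp h2 0
    have := hu.map (shiftHom v)
    rwa [e1'] at this
  obtain ⟨a, b, r, hr, hab⟩ := gauss_relPrime _ _ hF hrel
  refine ⟨r, hr, fun x t h1 h2 => ?_⟩
  have := congrArg (Polynomial.eval₂ (MvPolynomial.eval x) t) hab
  rw [Polynomial.eval₂_add, Polynomial.eval₂_mul, Polynomial.eval₂_mul, shiftHom_eval,
    shiftHom_eval, h1, h2, Polynomial.eval₂_C] at this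
  simpa using this.symm

theorem exists_ne_zero_of_open {n : ℕ} (r : MvPolynomial (Fin n) ℝ) (hr : r ≠ 0)
    (V : Set (Fin n → ℝ)) (hV : IsOpen V) (hne : V.Nonempty) :
    ∃ x ∈ V, MvPolynomial.eval x r ≠ 0 := by
  by_contra! hcon
  obtain ⟨x, hx⟩ := hne
  obtain ⟨ε, hε, hball⟩ := Metric.isOpen_iff.mp hV x hx
  apply hr
  refine MvPolynomial.funext_set (fun i => Metric.ball (x i) ε) (fun i => ?_) fun y hy => ?_
  · rw [Real.ball_eq_Ioo]
    exact Set.Ioo_infinite (by linarith)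
  · rw [map_zero]
    exact hcon y (hball (by rw [ball_pi _ hε]; exact hy))

theorem local_case {n : ℕ} (f g : MvPolynomial (Fin n) ℝ) (hf : f ≠ 0) (hg : g ≠ 0)
    (hfg : IsRelPrime f g) (U : Set (Fin n → ℝ)) (hU : IsOpen U) (hconv : Convex ℝ U)
    (h : ∀ a ∈ U, 0 ≤ MvPolynomial.eval a f * MvPolynomial.eval a g) :
    (∀ a ∈ U, 0 ≤ MvPolynomial.eval a f ∧ 0 ≤ MvPolynomial.eval a g) ∨
    (∀ a ∈ U, MvPolynomial.eval a f ≤ 0 ∧ MvPolynomial.eval a g ≤ 0) := by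
  have cf : Continuous fun x : Fin n → ℝ => MvPolynomial.eval x f := MvPolynomial.continuous_eval f
  have cg : Continuous fun x : Fin n → ℝ => MvPolynomial.eval x g := MvPolynomial.continuous_eval g
  by_contra! hcon
  obtain ⟨⟨b, hb, hb'⟩, ⟨a, ha, ha'⟩⟩ := hcon
  -- a point where both are positive
  have hA : ∃ a ∈ U, 0 < MvPolynomial.eval a f ∧ 0 < MvPolynomial.eval a g := by
    obtain ⟨y, ⟨hyU, hy⟩, hy0⟩ := exists_ne_zero_of_open (f * g) (mul_ne_zero hf hg)
      (U ∩ {x | 0 < MvPolynomial.eval x f ∨ 0 < MvPolynomial.eval x g})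
      (hU.inter ((isOpen_lt continuous_const cf).union (isOpen_lt continuous_const cg)))
      ⟨a, ha, by
        by_cases h0 : MvPolynomial.eval a f ≤ 0
        · exact Or.inr (ha' h0)
        · exact Or.inl (not_le.mp h0)⟩
    rw [map_mul] at hy0
    have hpos := lt_of_le_of_ne (h y hyU) hy0.symm
    refine ⟨y, hyU, ?_⟩
    rcases hy with hy | hy
    · exact ⟨hy, (pos_iff_pos_of_mul_pos hpos).mp hy⟩
    · exact ⟨(pos_iff_pos_of_mul_pos hpos).mpr hy, hy⟩
  have hB : ∃ a ∈ U, MvPolynomial.eval a f < 0 ∧ MvPolynomial.eval a g < 0 := by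
    obtain ⟨y, ⟨hyU, hy⟩, hy0⟩ := exists_ne_zero_of_open (f * g) (mul_ne_zero hf hg)
      (U ∩ {x | MvPolynomial.eval x f < 0 ∨ MvPolynomial.eval x g < 0})
      (hU.inter ((isOpen_lt cf continuous_const).union (isOpen_lt cg continuous_const)))
      ⟨b, hb, by
        by_cases h0 : 0 ≤ MvPolynomial.eval b f
        · exact Or.inr (hb' h0)
        · exact Or.inl (not_le.mp h0)⟩
    rw [map_mul] at hy0
    have hpos := lt_of_le_of_ne (h y hyU) hy0.symm
    refine ⟨y, hyU, ?_⟩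
    rcases hy with hy | hy
    · exact ⟨hy, (neg_iff_neg_of_mul_pos hpos).mp hy⟩
    · exact ⟨(neg_iff_neg_of_mul_pos hpos).mpr hy, hy⟩
  clear hb hb' ha ha' a b
  obtain ⟨a, haU, haf, hag⟩ := hA
  obtain ⟨b, hbU, hbf, hbg⟩ := hB
  obtain ⟨r, hr, hline⟩ := exists_line f g hf hfg (b - a)
  have cs : Continuous fun x : Fin n → ℝ => x + (b - a) := by fun_prop
  obtain ⟨x, ⟨⟨⟨hxU, hxf⟩, hxg⟩, hyU, hyf, hyg⟩, hx0⟩ := exists_ne_zero_of_open r hr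
    ((U ∩ {x | 0 < MvPolynomial.eval x f} ∩ {x | 0 < MvPolynomial.eval x g}) ∩
      (fun x => x + (b - a)) ⁻¹'
        (U ∩ ({x | MvPolynomial.eval x f < 0} ∩ {x | MvPolynomial.eval x g < 0})))
    (((hU.inter (isOpen_lt continuous_const cf)).inter (isOpen_lt continuous_const cg)).inter
      ((hU.inter ((isOpen_lt cf continuous_const).inter
        (isOpen_lt cg continuous_const))).preimage cs))
    ⟨a, ⟨⟨haU, haf⟩, hag⟩, by simpa using ⟨hbU, hbf, hbg⟩⟩
  have cl : Continuous fun t : ℝ => x + t • (b - a) := by fun_prop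
  have hmemU : ∀ t ∈ Set.Icc (0 : ℝ) 1, x + t • (b - a) ∈ U := by
    intro t ht
    exact hconv.add_smul_mem hxU hyU ht
  simp only [Set.mem_setOf_eq] at hxf hxg hyf hyg
  obtain ⟨t, ht, ht0⟩ := intermediate_value_Icc' (zero_le_one' ℝ)
    (f := fun t : ℝ => MvPolynomial.eval (x + t • (b - a)) f +
      MvPolynomial.eval (x + t • (b - a)) g)
    ((cf.comp cl).add (cg.comp cl)).continuousOn
    (show (0 : ℝ) ∈ _ by
      simp only [zero_smul, one_smul, add_zero, Set.mem_Icc]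
      constructor <;> linarith)
  have hnn := h _ (hmemU t ht)
  simp only at ht0
  have hf0 : MvPolynomial.eval (x + t • (b - a)) f = 0 := by nlinarith
  exact hx0 (hline x t hf0 (by linarith))

end Helpers

theorem stmt_8 (n : ℕ) (f g : MvPolynomial (Fin n) ℝ) (hfg : IsRelPrime f g)
    (U : Set (Fin n → ℝ)) (hUopen : IsOpen U) (hUconn : IsConnected U)
    (h : ∀ a ∈ U, 0 ≤ MvPolynomial.eval a f * MvPolynomial.eval a g) :
    (∀ a ∈ U, 0 ≤ MvPolynomial.eval a f ∧ 0 ≤ MvPolynomial.eval a g) ∨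
    (∀ a ∈ U, MvPolynomial.eval a f ≤ 0 ∧ MvPolynomial.eval a g ≤ 0) := by
  have unit_case : ∀ p : MvPolynomial (Fin n) ℝ, IsUnit p →
      (∀ a : Fin n → ℝ, 0 ≤ MvPolynomial.eval a p) ∨ (∀ a : Fin n → ℝ, MvPolynomial.eval a p ≤ 0) := by
    intro p hp
    obtain ⟨c, -, rfl⟩ := MvPolynomial.isUnit_iff_eq_C_of_isReduced.mp hp
    simpa using le_total 0 c
  by_cases hf : f = 0
  · subst hf
    rcases unit_case g (isRelPrime_zero_left.mp hfg) with hg | hg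
    · exact Or.inl fun a _ => ⟨by simp, hg a⟩
    · exact Or.inr fun a _ => ⟨by simp, hg a⟩
  by_cases hg : g = 0
  · subst hg
    rcases unit_case f (isRelPrime_zero_right.mp hfg) with hf | hf
    · exact Or.inl fun a _ => ⟨hf a, by simp⟩
    · exact Or.inr fun a _ => ⟨hf a, by simp⟩
  let A := {x : Fin n → ℝ | ∀ᶠ y in nhds x, 0 ≤ MvPolynomial.eval y f ∧ 0 ≤ MvPolynomial.eval y g}
  let B := {x : Fin n → ℝ | ∀ᶠ y in nhds x, MvPolynomial.eval y f ≤ 0 ∧ MvPolynomial.eval y g ≤ 0}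
  have hAo : IsOpen A := isOpen_setOf_eventually_nhds
  have hBo : IsOpen B := isOpen_setOf_eventually_nhds
  have hcov : U ⊆ A ∪ B := by
    intro x hx
    obtain ⟨ε, hε, hball⟩ := Metric.isOpen_iff.mp hUopen x hx
    have hmem : Metric.ball x ε ∈ nhds x := Metric.ball_mem_nhds x hε
    rcases local_case f g hf hg hfg (Metric.ball x ε) Metric.isOpen_ball (convex_ball x ε)
      (fun a ha => h a (hball ha)) with h1 | h1
    · exact Or.inl (Filter.mem_of_superset hmem h1)
    · exact Or.inr (Filter.mem_of_superset hmem h1)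
  by_cases hUA : (U ∩ A).Nonempty
  · by_cases hUB : (U ∩ B).Nonempty
    · exfalso
      obtain ⟨x, -, hxA, hxB⟩ := hUconn.isPreconnected A B hAo hBo hcov hUA hUB
      obtain ⟨y, ⟨hyA, hyB⟩, hy⟩ := exists_ne_zero_of_open f hf (A ∩ B) (hAo.inter hBo) ⟨x, hxA, hxB⟩
      have h1 := hyA.self_of_nhds
      have h2 := hyB.self_of_nhds
      exact hy (le_antisymm h2.1 h1.1)
    · left
      intro a ha
      rcases hcov ha with h1 | h1
      · exact h1.self_of_nhds
      · exact absurd ⟨a, ha, h1⟩ hUB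
  · right
    intro a ha
    rcases hcov ha with h1 | h1
    · exact absurd ⟨a, ha, h1⟩ hUA
    · exact h1.self_of_nhds
end

section
/- Let U ⊆ ℝⁿ be a connected open set and f, g ∈ ℝ[x₁,…,xₙ] coprime polynomials with f(a)·g(a) ≤ 0 for all a ∈ U. Then either f(a) ≥ 0 and g(a) ≤ 0 for all a ∈ U, or f(a) ≤ 0 and g(a) ≥ 0 for all a ∈ U. -/
open MvPolynomial

/-- Gauss: relatively prime polynomials over a UFD admit a Bezout relation with nonzero
constant right-hand side. -/
theorem aux_gauss {R : Type*} [CommRing R] [IsDomain R] [UniqueFactorizationMonoid R]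
    (F G : Polynomial R) (h : IsRelPrime F G) :
    ∃ (A B : Polynomial R) (d : R), d ≠ 0 ∧ A * F + B * G = Polynomial.C d := by
  classical
  have : NormalizedGCDMonoid R := Nonempty.some inferInstance
  let K := FractionRing R
  have hinj : Function.Injective (Polynomial.map (algebraMap R K)) :=
    Polynomial.map_injective _ (IsFractionRing.injective R K)
  have hrel : IsRelPrime (F.map (algebraMap R K)) (G.map (algebraMap R K)) := by
    intro D hDF hDG
    by_cases hD : D = 0
    · subst hD
      rw [zero_dvd_iff] at hDF hDG
      have hF : F = 0 := hinj (by simpa using hDF)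
      have hG : G = 0 := hinj (by simpa using hDG)
      subst hF hG
      have := h (dvd_refl 0) (dvd_refl 0)
      exact absurd this not_isUnit_zero
    · obtain ⟨b, hb, hs⟩ := IsLocalization.integerNormalization_spec (nonZeroDivisors R) D
      set N := IsLocalization.integerNormalization (nonZeroDivisors R) D with hN
      have hb0 : algebraMap R K b ≠ 0 := by
        intro h0
        exact nonZeroDivisors.ne_zero hb (IsFractionRing.injective R K (by simpa using h0))
      have hND : N.map (algebraMap R K) ∣ D := by
        rw [hs]
        refine ⟨Polynomial.C (algebraMap R K b)⁻¹, ?_⟩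
        rw [Algebra.smul_def, Polynomial.algebraMap_apply, mul_right_comm, ← Polynomial.C_mul,
          mul_inv_cancel₀ hb0]
        simp
      have hpp : N.primPart.map (algebraMap R K) ∣ D :=
        (Polynomial.map_dvd _ N.primPart_dvd).trans hND
      have hu : IsUnit N.primPart :=
        h (N.isPrimitive_primPart.dvd_of_fraction_map_dvd_fraction_map (hpp.trans hDF))
          (N.isPrimitive_primPart.dvd_of_fraction_map_dvd_fraction_map (hpp.trans hDG))
      exact Polynomial.isUnit_or_eq_zero_of_isUnit_integerNormalization_primPart hD hu
  obtain ⟨a, b, hab⟩ := hrel.isCoprime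
  obtain ⟨c, hc, hcs⟩ := IsLocalization.integerNormalization_spec (nonZeroDivisors R) a
  obtain ⟨e, he, hes⟩ := IsLocalization.integerNormalization_spec (nonZeroDivisors R) b
  refine ⟨Polynomial.C e * IsLocalization.integerNormalization (nonZeroDivisors R) a,
    Polynomial.C c * IsLocalization.integerNormalization (nonZeroDivisors R) b, c * e,
    mul_ne_zero (nonZeroDivisors.ne_zero hc) (nonZeroDivisors.ne_zero he), hinj ?_⟩
  rw [Algebra.smul_def, Polynomial.algebraMap_apply] at hcs hes
  simp only [Polynomial.map_add, Polynomial.map_mul, Polynomial.map_C, hcs, hes, map_mul]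
  linear_combination (Polynomial.C (algebraMap R K c) * Polynomial.C (algebraMap R K e)) * hab

/-- The substitution `x ↦ x + t v`, on `ℝ[x][t]`. -/
noncomputable def auxShift {n : ℕ} (v : Fin n → ℝ) :
    Polynomial (MvPolynomial (Fin n) ℝ) →+* Polynomial (MvPolynomial (Fin n) ℝ) :=
  Polynomial.eval₂RingHom
    (MvPolynomial.eval₂Hom (Polynomial.C.comp MvPolynomial.C)
      (fun i => Polynomial.C (X i) + Polynomial.X * Polynomial.C (C (v i)))) Polynomial.X

theorem auxShift_inv {n : ℕ} (v w : Fin n → ℝ) (hw : ∀ i, w i = - v i)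
    (D : Polynomial (MvPolynomial (Fin n) ℝ)) :
    auxShift v (auxShift w D) = D := by
  have : (auxShift v).comp (auxShift w) = RingHom.id _ := by
    apply Polynomial.ringHom_ext'
    · apply MvPolynomial.ringHom_ext
      · intro r; simp [auxShift]
      · intro i; simp [auxShift, hw]; ring
    · simp [auxShift]
  exact congrArg (fun φ => φ D) this

theorem aux_C {R : Type*} [CommRing R] [IsDomain R] (f g : R) (h : IsRelPrime f g) :
    IsRelPrime (Polynomial.C f) (Polynomial.C g) := by
  intro D hf hg
  have key : ∀ f : R, f ≠ 0 → D ∣ Polynomial.C f → ∃ a, D = Polynomial.C a := by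
    intro f hf0 hD
    refine ⟨D.coeff 0, Polynomial.eq_C_of_natDegree_eq_zero ?_⟩
    have := Polynomial.natDegree_le_of_dvd hD (by simpa using hf0)
    simpa using this
  have : ∃ a, D = Polynomial.C a := by
    by_cases hf0 : f = 0
    · by_cases hg0 : g = 0
      · subst hf0 hg0
        exact absurd (h (dvd_refl 0) (dvd_refl 0)) not_isUnit_zero
      · exact key g hg0 hg
    · exact key f hf0 hf
  obtain ⟨a, rfl⟩ := this
  rw [Polynomial.C_dvd_iff_dvd_coeff] at hf hg
  exact (h (by simpa using hf 0) (by simpa using hg 0)).map Polynomial.C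

theorem auxShift_rel {n : ℕ} (v : Fin n → ℝ) (f g : MvPolynomial (Fin n) ℝ)
    (h : IsRelPrime f g) :
    IsRelPrime (auxShift v (Polynomial.C f)) (auxShift v (Polynomial.C g)) := by
  intro D hf hg
  have h1 := map_dvd (auxShift (-v)) hf
  have h2 := map_dvd (auxShift (-v)) hg
  rw [auxShift_inv _ _ (by simp)] at h1 h2
  have := (aux_C f g h h1 h2).map (auxShift v)
  rwa [auxShift_inv _ _ (by simp)] at this

theorem auxShift_eval {n : ℕ} (v x : Fin n → ℝ) (t : ℝ) (f : MvPolynomial (Fin n) ℝ) :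
    Polynomial.eval₂ (MvPolynomial.eval x) t (auxShift v (Polynomial.C f)) =
      MvPolynomial.eval (x + t • v) f := by
  have : ((Polynomial.eval₂RingHom (MvPolynomial.eval x) t).comp
      ((auxShift v).comp Polynomial.C)) = MvPolynomial.eval (x + t • v) := by
    apply MvPolynomial.ringHom_ext
    · intro r; simp [auxShift]
    · intro i; simp [auxShift]; ring
  exact congrArg (fun φ => φ f) this

/-- For a fixed direction, generic lines in this direction avoid the common zeros. -/
theorem aux_line {n : ℕ} (v : Fin n → ℝ) (f g : MvPolynomial (Fin n) ℝ)
    (h : IsRelPrime f g) :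
    ∃ d : MvPolynomial (Fin n) ℝ, d ≠ 0 ∧ ∀ x, eval x d ≠ 0 → ∀ t : ℝ,
      ¬ (eval (x + t • v) f = 0 ∧ eval (x + t • v) g = 0) := by
  obtain ⟨A, B, d, hd, hAB⟩ := aux_gauss _ _ (auxShift_rel v f g h)
  refine ⟨d, hd, fun x hx t ⟨h1, h2⟩ => hx ?_⟩
  have := congrArg (Polynomial.eval₂ (MvPolynomial.eval x) t) hAB
  rw [Polynomial.eval₂_add, Polynomial.eval₂_mul, Polynomial.eval₂_mul, auxShift_eval,
    auxShift_eval, h1, h2, Polynomial.eval₂_C] at this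
  simpa using this.symm

theorem aux_nonzero {n : ℕ} (d : MvPolynomial (Fin n) ℝ) (hd : d ≠ 0)
    (W : Set (Fin n → ℝ)) (hW : IsOpen W) (p : Fin n → ℝ) (hp : p ∈ W) :
    ∃ x ∈ W, eval x d ≠ 0 := by
  by_contra! hcon
  obtain ⟨ε, hε, hball⟩ := Metric.isOpen_iff.1 hW p hp
  apply hd
  apply MvPolynomial.funext_set (fun i => Metric.ball (p i) ε)
  · intro i
    rw [Real.ball_eq_Ioo]
    exact Set.Ioo_infinite (by linarith)
  · intro x hx
    rw [map_zero]
    apply hcon x (hball _)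
    rw [ball_pi _ hε]
    exact hx

theorem aux_local {n : ℕ} (f g : MvPolynomial (Fin n) ℝ) (hfg : IsRelPrime f g)
    (U : Set (Fin n → ℝ)) (hUopen : IsOpen U) (hconv : Convex ℝ U)
    (h : ∀ a ∈ U, eval a f * eval a g ≤ 0) :
    (∀ a ∈ U, 0 ≤ eval a (f - g)) ∨ (∀ a ∈ U, eval a (f - g) ≤ 0) := by
  by_contra! hcon
  obtain ⟨⟨q, hqU, hq⟩, ⟨p, hpU, hp⟩⟩ := hcon
  obtain ⟨d, hd, hline⟩ := aux_line (q - p) f g hfg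
  have hc : Continuous fun x : Fin n → ℝ => eval x (f - g) := MvPolynomial.continuous_eval _
  have hs : Continuous fun x : Fin n → ℝ => x + (q - p) := by fun_prop
  have hW : IsOpen (U ∩ {x | 0 < eval x (f - g)} ∩
      ((fun x => x + (q - p)) ⁻¹' (U ∩ {x | eval x (f - g) < 0}))) :=
    (hUopen.inter (isOpen_lt continuous_const hc)).inter
      ((hUopen.inter (isOpen_lt hc continuous_const)).preimage hs)
  obtain ⟨x, ⟨⟨hxU, hx0⟩, hyU, hy0⟩, hxd⟩ := aux_nonzero d hd _ hW p
    ⟨⟨hpU, hp⟩, by simpa using ⟨hqU, by simpa using hq⟩⟩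
  have hcl : ContinuousOn (fun t : ℝ => eval (x + t • (q - p)) (f - g)) (Set.Icc 0 1) :=
    (hc.comp (by fun_prop : Continuous fun t : ℝ => x + t • (q - p))).continuousOn
  have hx1 : 0 < eval x (f - g) := hx0
  have hy1 : eval (x + (q - p)) (f - g) < 0 := hy0
  obtain ⟨t, ht, hzero⟩ := intermediate_value_Icc' (zero_le_one) hcl
    (show (0 : ℝ) ∈ _ from ⟨by simpa only [one_smul] using hy1.le,
      by simpa only [zero_smul, add_zero] using hx1.le⟩)
  have htU : x + t • (q - p) ∈ U := by
    have := hconv.add_smul_mem hxU hyU ht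
    exact this
  have h1 := h _ htU
  simp only [map_sub] at hzero
  have h2 : eval (x + t • (q - p)) f = eval (x + t • (q - p)) g := sub_eq_zero.1 hzero
  rw [← h2] at h1
  have h3 : eval (x + t • (q - p)) f = 0 := mul_self_eq_zero.1 (le_antisymm h1 (mul_self_nonneg _))
  exact hline x hxd t ⟨h3, h2 ▸ h3⟩

theorem stmt_9 (n : ℕ) (f g : MvPolynomial (Fin n) ℝ) (hfg : IsRelPrime f g)
    (U : Set (Fin n → ℝ)) (hUopen : IsOpen U) (hUconn : IsConnected U)
    (h : ∀ a ∈ U, MvPolynomial.eval a f * MvPolynomial.eval a g ≤ 0) :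
    (∀ a ∈ U, 0 ≤ MvPolynomial.eval a f ∧ MvPolynomial.eval a g ≤ 0) ∨
    (∀ a ∈ U, MvPolynomial.eval a f ≤ 0 ∧ 0 ≤ MvPolynomial.eval a g) := by
  have hA : IsOpen (interior {x | 0 ≤ eval x (f - g)}) := isOpen_interior
  have hB : IsOpen (interior {x | eval x (f - g) ≤ 0}) := isOpen_interior
  have hcover : U ⊆ interior {x | 0 ≤ eval x (f - g)} ∪ interior {x | eval x (f - g) ≤ 0} := by
    intro x hx
    obtain ⟨ε, hε, hball⟩ := Metric.isOpen_iff.1 hUopen x hx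
    rcases aux_local f g hfg (Metric.ball x ε) Metric.isOpen_ball (convex_ball x ε)
      (fun a ha => h a (hball ha)) with h1 | h1
    · exact Or.inl (mem_interior.2 ⟨_, h1, Metric.isOpen_ball, Metric.mem_ball_self hε⟩)
    · exact Or.inr (mem_interior.2 ⟨_, h1, Metric.isOpen_ball, Metric.mem_ball_self hε⟩)
  have hor : U ⊆ interior {x | 0 ≤ eval x (f - g)} ∨ U ⊆ interior {x | eval x (f - g) ≤ 0} := by
    by_contra! hcon
    obtain ⟨hn1, hn2⟩ := hcon
    obtain ⟨a, haU, ha⟩ := Set.not_subset.1 hn1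
    obtain ⟨b, hbU, hb⟩ := Set.not_subset.1 hn2
    obtain ⟨p, hpU, hpA, hpB⟩ := hUconn.isPreconnected _ _ hA hB hcover
      ⟨b, hbU, (hcover hbU).resolve_right hb⟩ ⟨a, haU, (hcover haU).resolve_left ha⟩
    obtain ⟨d, hd, hline⟩ := aux_line 0 f g hfg
    obtain ⟨x, ⟨hxU, hxA, hxB⟩, hxd⟩ := aux_nonzero d hd _ (hUopen.inter (hA.inter hB)) p
      ⟨hpU, hpA, hpB⟩
    have h0 : eval x (f - g) = 0 := le_antisymm
      (show x ∈ {x | eval x (f - g) ≤ 0} from interior_subset hxB)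
      (show x ∈ {x | 0 ≤ eval x (f - g)} from interior_subset hxA)
    have h1 := h x hxU
    rw [map_sub] at h0
    have h2 : eval x f = eval x g := sub_eq_zero.1 h0
    rw [← h2] at h1
    have h3 : eval x f = 0 := mul_self_eq_zero.1 (le_antisymm h1 (mul_self_nonneg _))
    exact hline x hxd 0 (by simpa using ⟨h3, h2 ▸ h3⟩)
  rcases hor with h1 | h1
  · left
    intro a ha
    have h2 : a ∈ {x | 0 ≤ eval x (f - g)} := interior_subset (h1 ha)
    have h3 := h a ha
    rw [Set.mem_ofPred_eq, map_sub] at h2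
    constructor <;> nlinarith
  · right
    intro a ha
    have h2 : a ∈ {x | eval x (f - g) ≤ 0} := interior_subset (h1 ha)
    have h3 := h a ha
    rw [Set.mem_ofPred_eq, map_sub] at h2
    constructor <;> nlinarith
end

section
/- Let f ∈ ℝ[x₁,…,xₙ] be a nonconstant polynomial. Then f is nonnegative on all of ℝⁿ if and only if every irreducible factor of f appearing with odd multiplicity is nonnegative on all of ℝⁿ (after choosing signs so their product with the even-multiplicity part and the leading constant is nonnegative). -/
open MvPolynomial

/-- The leading coefficient of a multivariate polynomial with respect to the
lexicographic monomial order ("monic under a suitable ordering" in the paper). -/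
noncomputable def lexLeadCoeff {n : ℕ} (p : MvPolynomial (Fin n) ℝ) : ℝ :=
  if h : p = 0 then 0
  else p.coeff (ofLex ((p.support.image toLex).max'
    (Finset.Nonempty.image (MvPolynomial.support_nonempty.mpr h) _)))

/-- A multivariate polynomial is lex-monic if its lex leading coefficient is `1`. -/
noncomputable def LexMonic {n : ℕ} (p : MvPolynomial (Fin n) ℝ) : Prop :=
  lexLeadCoeff p = 1

lemma digits_lt {n : ℕ} (D : ℕ) (u : Fin n → ℕ) (hu : ∀ i, u i < D) :
    ∑ i, D ^ (i.rev : ℕ) * u i < D ^ n := by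
  induction n with
  | zero => simp
  | succ n ih =>
    rw [Fin.sum_univ_succ]
    have h1 := ih (fun i => u i.succ) (fun i => hu _)
    have h2 : ∀ i : Fin n, ((i.succ).rev : ℕ) = (i.rev : ℕ) := by
      intro i; simp [Fin.val_rev]
    simp only [h2]
    have h3 : (((0 : Fin (n+1)).rev : Fin (n+1)) : ℕ) = n := by simp [Fin.val_rev]
    rw [h3]
    have h4 : D ^ n * (u 0 + 1) ≤ D ^ n * D := Nat.mul_le_mul_left _ (hu 0)
    rw [pow_succ]
    linarith

lemma digits_lex {n : ℕ} (D : ℕ) (u v : Fin n → ℕ) (hu : ∀ i, u i < D)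
    (h : ∃ k, (∀ i, i < k → u i = v i) ∧ u k < v k) :
    ∑ i, D ^ (i.rev : ℕ) * u i < ∑ i, D ^ (i.rev : ℕ) * v i := by
  induction n with
  | zero => obtain ⟨k, _⟩ := h; exact k.elim0
  | succ n ih =>
    have h2 : ∀ i : Fin n, ((i.succ).rev : ℕ) = (i.rev : ℕ) := by
      intro i; simp [Fin.val_rev]
    have h3 : (((0 : Fin (n+1)).rev : Fin (n+1)) : ℕ) = n := by simp [Fin.val_rev]
    rw [Fin.sum_univ_succ, Fin.sum_univ_succ]
    simp only [h2, h3]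
    obtain ⟨k, hk1, hk2⟩ := h
    induction k using Fin.cases with
    | zero =>
      have h1 := digits_lt D (fun i => u i.succ) (fun i => hu _)
      have h4 : D ^ n * (u 0 + 1) ≤ D ^ n * v 0 := Nat.mul_le_mul_left _ hk2
      have h5 : 0 ≤ ∑ i : Fin n, D ^ (i.rev : ℕ) * v i.succ := Nat.zero_le _
      linarith
    | succ k =>
      rw [hk1 0 (Fin.succ_pos k)]
      have := ih (fun i => u i.succ) (fun i => v i.succ) (fun i => hu _)
        ⟨k, fun i hi => hk1 _ (Fin.succ_lt_succ_iff.mpr hi), hk2⟩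
      linarith

lemma lexMonic_spec {n : ℕ} {p : MvPolynomial (Fin n) ℝ} (h : LexMonic p) :
    ∃ m₀, p.coeff m₀ = 1 ∧ ∀ m ∈ p.support, toLex m ≤ toLex m₀ := by
  unfold LexMonic lexLeadCoeff at h
  split_ifs at h with h0
  · exact absurd h (by norm_num)
  · refine ⟨_, h, fun m hm => ?_⟩
    exact Finset.le_max' (p.support.image toLex) (toLex m) (Finset.mem_image_of_mem _ hm)

lemma lexMonic_assoc {n : ℕ} {p q : MvPolynomial (Fin n) ℝ} (hp : LexMonic p) (hq : LexMonic q)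
    (h : Associated p q) : p = q := by
  obtain ⟨m, hm1, hm2⟩ := lexMonic_spec hp
  obtain ⟨m', hm1', hm2'⟩ := lexMonic_spec hq
  obtain ⟨u, hu⟩ := h
  obtain ⟨c, hc, hcu⟩ := MvPolynomial.isUnit_iff_eq_C_of_isReduced.mp u.isUnit
  rw [hcu, mul_comm] at hu
  have hco : ∀ d, q.coeff d = c * p.coeff d := by intro d; rw [← hu, coeff_C_mul]
  have hc0 : c ≠ 0 := hc.ne_zero
  have e1 := hm2 m' (by
    rw [mem_support_iff]; intro h0; have := hco m'; rw [h0, hm1'] at this; simp at this)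
  have e2 := hm2' m (by
    rw [mem_support_iff, hco, hm1]; simpa using hc0)
  have e : m = m' := toLex.injective (le_antisymm e2 e1)
  subst e
  have := hco m
  rw [hm1, hm1'] at this
  have : c = 1 := by linarith
  rw [← hu, this]; simp

lemma lexMonic_pos {n : ℕ} {p : MvPolynomial (Fin n) ℝ} (hp : LexMonic p) :
    ∃ x, 0 < eval x p := by
  obtain ⟨m₀, h1, h2⟩ := lexMonic_spec hp
  obtain ⟨D, hD⟩ : ∃ D, ∀ m ∈ p.support, ∀ i, m i < D := by
    refine ⟨(p.support.sup fun m => Finset.univ.sup fun i => m i) + 1, fun m hm i => ?_⟩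
    have a1 : m i ≤ Finset.univ.sup fun i => m i := Finset.le_sup (f := fun i => m i) (Finset.mem_univ i)
    have a2 := Finset.le_sup (f := fun m : Fin n →₀ ℕ => Finset.univ.sup fun i => m i) hm
    omega
  set W : (Fin n →₀ ℕ) → ℕ := fun m => ∑ i, D ^ ((i.rev : Fin n) : ℕ) * m i with hW
  have hlt : ∀ m ∈ p.support, m ≠ m₀ → W m < W m₀ := by
    intro m hm hne
    have : toLex m < toLex m₀ := lt_of_le_of_ne (h2 m hm) (fun h => hne (toLex.injective h))
    rw [Finsupp.Lex.lt_iff] at this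
    exact digits_lex D m m₀ (hD m hm) this
  have hm₀ : m₀ ∈ p.support := by rw [mem_support_iff, h1]; norm_num
  set P : Polynomial ℝ := ∑ m ∈ p.support, Polynomial.monomial (W m) (p.coeff m) with hP
  have hev : ∀ T : ℝ, P.eval T = eval (fun i => T ^ (D ^ ((i.rev : Fin n) : ℕ))) p := by
    intro T
    rw [eval_eq', hP, Polynomial.eval_finset_sum]
    refine Finset.sum_congr rfl fun m _ => ?_
    rw [Polynomial.eval_monomial, hW]
    simp only [← pow_mul, Finset.prod_pow_eq_pow_sum]
  have hco : P.coeff (W m₀) = 1 := by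
    rw [hP, Polynomial.finset_sum_coeff, Finset.sum_eq_single m₀]
    · simp [h1]
    · intro m hm hne
      rw [Polynomial.coeff_monomial, if_neg (hlt m hm hne).ne]
    · intro h; exact absurd hm₀ h
  have hdeg : P.natDegree ≤ W m₀ := by
    refine Polynomial.natDegree_sum_le_of_forall_le _ _ fun m hm => ?_
    refine (Polynomial.natDegree_monomial_le _).trans ?_
    by_cases h : m = m₀
    · rw [h]
    · exact (hlt m hm h).le
  have hmon : P.Monic := Polynomial.monic_of_natDegree_le_of_coeff_eq_one _ hdeg hco
  obtain ⟨T, hT⟩ : ∃ T : ℝ, 0 < P.eval T := by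
    by_cases hd : 0 < P.degree
    · have := Polynomial.tendsto_atTop_of_leadingCoeff_nonneg P hd (by rw [hmon.leadingCoeff]; norm_num)
      exact (this.eventually_gt_atTop 0).exists
    · have : P = 1 := by
        apply hmon.natDegree_eq_zero.mp
        by_contra h
        exact hd (Polynomial.natDegree_pos_iff_degree_pos.mp (Nat.pos_of_ne_zero h))
      exact ⟨0, by rw [this]; simp⟩
  exact ⟨_, by rw [hev] at hT; exact hT⟩

lemma exists_ne_zero_of_isOpen {n : ℕ} {d : MvPolynomial (Fin n) ℝ} (hd : d ≠ 0)
    {U : Set (Fin n → ℝ)} (hU : IsOpen U) {x : Fin n → ℝ} (hx : x ∈ U) :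
    ∃ y ∈ U, eval y d ≠ 0 := by
  by_contra! hcon
  obtain ⟨ε, hε, hb⟩ := Metric.isOpen_iff.mp hU x hx
  apply hd
  refine MvPolynomial.funext_set (fun i => Metric.ball (x i) ε) (fun i => ?_) (fun y hy => ?_)
  · rw [Real.ball_eq_Ioo]; exact Set.Ioo_infinite (by linarith)
  · rw [map_zero]
    apply hcon
    apply hb
    rw [ball_pi _ hε]
    exact hy

lemma cont_eval {n : ℕ} (p : MvPolynomial (Fin n) ℝ) : Continuous fun x => eval x p :=
  MvPolynomial.continuous_eval p

/-- Bezout relation over a fraction field, with denominators cleared. -/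
lemma bezout {R : Type*} [CommRing R] [IsDomain R] [UniqueFactorizationMonoid R]
    (p q : Polynomial R) (hp : Irreducible p) (hdeg : p.natDegree ≠ 0) (hpq : ¬ p ∣ q) :
    ∃ (u v : Polynomial R) (d : R), d ≠ 0 ∧ u * p + v * q = Polynomial.C d := by
  let K := FractionRing R
  have hprim := hp.isPrimitive hdeg
  have hirr := (hprim.irreducible_iff_irreducible_map_fraction_map (K := K)).mp hp
  have hnd : ¬ p.map (algebraMap R K) ∣ q.map (algebraMap R K) := fun h =>
    hpq (hprim.dvd_of_fraction_map_dvd_fraction_map h)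
  obtain ⟨u, v, huv⟩ := (hirr.coprime_iff_not_dvd).mpr hnd
  obtain ⟨b, hb, hb'⟩ := IsLocalization.integerNormalization_spec (nonZeroDivisors R) u
  obtain ⟨c, hc, hc'⟩ := IsLocalization.integerNormalization_spec (nonZeroDivisors R) v
  set u' := IsLocalization.integerNormalization (nonZeroDivisors R) u
  set v' := IsLocalization.integerNormalization (nonZeroDivisors R) v
  refine ⟨Polynomial.C c * u', Polynomial.C b * v', b * c,
    mul_ne_zero (nonZeroDivisors.ne_zero hb) (nonZeroDivisors.ne_zero hc), ?_⟩
  apply Polynomial.map_injective _ (IsFractionRing.injective R K)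
  have s1 : u'.map (algebraMap R K) = Polynomial.C (algebraMap R K b) * u := by
    rw [hb', ← algebraMap_smul K b u, Polynomial.smul_eq_C_mul]
  have s2 : v'.map (algebraMap R K) = Polynomial.C (algebraMap R K c) * v := by
    rw [hc', ← algebraMap_smul K c v, Polynomial.smul_eq_C_mul]
  simp only [Polynomial.map_add, Polynomial.map_mul, Polynomial.map_C, s1, s2, map_mul]
  linear_combination (Polynomial.C (algebraMap R K b) * Polynomial.C (algebraMap R K c)) * huv

/-- One-variable step: no common zeros and nonnegative product force constant sign. -/
lemma no_sign_change (f g : ℝ → ℝ) (hf : Continuous f) (hg : Continuous g)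
    (hfg : ∀ x, 0 ≤ f x * g x) (h0 : ∀ x, f x = 0 → g x ≠ 0) (s t : ℝ)
    (hs : f s < 0) (ht : 0 < f t) : False := by
  have hA : IsOpen ({x | 0 < f x} ∪ {x | 0 < g x}) :=
    (isOpen_lt continuous_const hf).union (isOpen_lt continuous_const hg)
  have hB : IsOpen ({x | f x < 0} ∪ {x | g x < 0}) :=
    (isOpen_lt hf continuous_const).union (isOpen_lt hg continuous_const)
  obtain ⟨x, -, hx1, hx2⟩ := isPreconnected_univ _ _ hA hB
    (by
      intro x _
      rcases lt_trichotomy (f x) 0 with h | h | h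
      · exact Or.inr (Or.inl h)
      · rcases lt_or_gt_of_ne (h0 x h) with h' | h'
        · exact Or.inr (Or.inr h')
        · exact Or.inl (Or.inr h')
      · exact Or.inl (Or.inl h))
    ⟨t, trivial, Or.inl ht⟩ ⟨s, trivial, Or.inl hs⟩
  have := hfg x
  simp only [Set.mem_union, Set.mem_setOf_eq] at hx1 hx2
  rcases hx1 with h1 | h1 <;> rcases hx2 with h2 | h2 <;> nlinarith

lemma sign_axis {n : ℕ} (l g : MvPolynomial (Fin (n+1)) ℝ) (hl : Irreducible l) (hlg : ¬ l ∣ g)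
    (hpos : ∀ x, 0 ≤ eval x l * eval x g) (s t : ℝ) (w : Fin n → ℝ)
    (hs : eval (Fin.cons s w : Fin (n+1) → ℝ) l < 0)
    (ht : 0 < eval (Fin.cons t w : Fin (n+1) → ℝ) l) : False := by
  let e := finSuccEquiv ℝ n
  have hirr : Irreducible (e l) := (MulEquiv.irreducible_iff e).mpr hl
  have hnd : ¬ e l ∣ e g := fun h => hlg ((map_dvd_iff e).mp h)
  by_cases hdeg : (e l).natDegree = 0
  · rw [eval_eq_eval_mv_eval'] at hs ht
    rw [Polynomial.eq_C_of_natDegree_eq_zero hdeg] at hs ht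
    simp only [Polynomial.map_C, Polynomial.eval_C] at hs ht
    linarith
  obtain ⟨u, v, d, hd, huv⟩ := bezout _ _ hirr hdeg hnd
  have hc : ∀ r : ℝ, Continuous fun w : Fin n → ℝ => eval (Fin.cons r w : Fin (n+1) → ℝ) l := by
    intro r
    refine (cont_eval l).comp (Continuous.finCons continuous_const continuous_id)
  have hU : IsOpen ({w : Fin n → ℝ | eval (Fin.cons s w : Fin (n+1) → ℝ) l < 0} ∩
      {w : Fin n → ℝ | 0 < eval (Fin.cons t w : Fin (n+1) → ℝ) l}) :=
    (isOpen_lt (hc s) continuous_const).inter (isOpen_lt continuous_const (hc t))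
  obtain ⟨y, ⟨hy1, hy2⟩, hy⟩ := exists_ne_zero_of_isOpen hd hU ⟨hs, ht⟩
  have hc' : ∀ p : MvPolynomial (Fin (n+1)) ℝ,
      Continuous fun r : ℝ => eval (Fin.cons r y : Fin (n+1) → ℝ) p := by
    intro p
    exact (cont_eval p).comp (Continuous.finCons continuous_id continuous_const)
  refine no_sign_change (fun r => eval (Fin.cons r y : Fin (n+1) → ℝ) l)
    (fun r => eval (Fin.cons r y : Fin (n+1) → ℝ) g) (hc' l) (hc' g) (fun r => hpos _) ?_ s t hy1 hy2
  intro r h1 h2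
  simp only [eval_eq_eval_mv_eval'] at h1 h2
  have := congrArg (fun P => Polynomial.eval r (Polynomial.map (eval y) P)) huv
  simp only [Polynomial.map_add, Polynomial.map_mul, Polynomial.eval_add, Polynomial.eval_mul,
    Polynomial.map_C, Polynomial.eval_C] at this
  change Polynomial.eval r (Polynomial.map (eval y) (e l)) = 0 at h1
  change Polynomial.eval r (Polynomial.map (eval y) (e g)) = 0 at h2
  rw [h1, h2] at this
  apply hy
  linarith

/-- The shear `X_{k+1} ↦ X_{k+1} + c_k X_0`. -/
noncomputable def shearHom {n : ℕ} (c : Fin n → ℝ) :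
    MvPolynomial (Fin (n+1)) ℝ →ₐ[ℝ] MvPolynomial (Fin (n+1)) ℝ :=
  aeval (Fin.cons (X 0) (fun k => X k.succ + C (c k) * X 0))

lemma shearHom_inv {n : ℕ} (c : Fin n → ℝ) :
    (shearHom c).comp (shearHom (-c)) = AlgHom.id ℝ _ := by
  apply MvPolynomial.algHom_ext
  intro k
  induction k using Fin.cases with
  | zero => simp [shearHom]
  | succ k => simp [shearHom]

noncomputable def shear {n : ℕ} (c : Fin n → ℝ) :
    MvPolynomial (Fin (n+1)) ℝ ≃ₐ[ℝ] MvPolynomial (Fin (n+1)) ℝ :=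
  AlgEquiv.ofAlgHom (shearHom c) (shearHom (-c)) (shearHom_inv c)
    (by simpa using shearHom_inv (-c))

lemma eval_shear {n : ℕ} (c : Fin n → ℝ) (r : ℝ) (w : Fin n → ℝ)
    (p : MvPolynomial (Fin (n+1)) ℝ) :
    eval (Fin.cons r w : Fin (n+1) → ℝ) (shear c p) =
      eval (Fin.cons r (fun k => w k + c k * r) : Fin (n+1) → ℝ) p := by
  change eval _ (shearHom c p) = _
  induction p using MvPolynomial.induction_on with
  | C a => simp [shearHom]
  | add p q hp hq => simp only [map_add, hp, hq]
  | mul_X p k hp =>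
    simp only [map_mul, hp]
    congr 1
    induction k using Fin.cases with
    | zero => simp [shearHom]
    | succ k => simp [shearHom]

lemma sign_main {n : ℕ} (l g : MvPolynomial (Fin n) ℝ) (hl : Irreducible l) (hlg : ¬ l ∣ g)
    (hpos : ∀ x, 0 ≤ eval x l * eval x g) (a b : Fin n → ℝ)
    (ha : eval a l < 0) (hb : 0 < eval b l) : False := by
  cases n with
  | zero =>
    rw [Subsingleton.elim a b] at ha
    linarith
  | succ n =>
    obtain ⟨b', hb', hne⟩ := exists_ne_zero_of_isOpen
      (d := (X 0 - C (a 0) : MvPolynomial (Fin (n+1)) ℝ))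
      (by
        intro h
        have := congrArg (eval (fun _ => a 0 + 1)) h
        simp at this)
      (isOpen_lt continuous_const (cont_eval l)) hb
    simp only [Set.mem_setOf_eq] at hb'
    have hne' : b' 0 - a 0 ≠ 0 := by simpa using hne
    let c : Fin n → ℝ := fun k => (b' k.succ - a k.succ) / (b' 0 - a 0)
    refine sign_axis (shear c l) (shear c g) ((MulEquiv.irreducible_iff (shear c)).mpr hl)
      (fun h => hlg ((map_dvd_iff (shear c)).mp h)) ?_ (a 0) (b' 0)
      (fun k => a k.succ - c k * a 0) ?_ ?_
    · intro x
      rw [← Fin.cons_self_tail x, eval_shear, eval_shear]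
      exact hpos _
    · rw [eval_shear]
      convert ha using 2
      congr 1
      funext k
      induction k using Fin.cases with
      | zero => simp
      | succ k => simp
    · rw [eval_shear]
      have hx : (Fin.cons (b' 0) (fun k => a k.succ - c k * a 0 + c k * b' 0) :
          Fin (n+1) → ℝ) = b' := by
        funext k
        induction k using Fin.cases with
        | zero => simp
        | succ k =>
          simp only [Fin.cons_succ, c]
          field_simp
          ring
      rw [hx]
      exact hb'

/-- a nonconstant `f = a · ∏ lₖ^(2jₖ-1) · ∏ hₛ^(2iₛ)` with `a > 0` and
`lₖ, hₛ` pairwise distinct monic irreducibles is nonnegative on `ℝⁿ` iff each odd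
factor `lₖ` is nonnegative on `ℝⁿ`. -/
theorem stmt_10 (n t m : ℕ) (a : ℝ) (ha : 0 < a)
    (L : Fin t → MvPolynomial (Fin n) ℝ) (H : Fin m → MvPolynomial (Fin n) ℝ)
    (j : Fin t → ℕ) (i : Fin m → ℕ) (hj : ∀ k, 1 ≤ j k)
    (hLirr : ∀ k, Irreducible (L k)) (hHirr : ∀ s, Irreducible (H s))
    (hLmonic : ∀ k, LexMonic (L k)) (hHmonic : ∀ s, LexMonic (H s))
    (hLinj : Function.Injective L) (hHinj : Function.Injective H)
    (hLH : ∀ k s, L k ≠ H s)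
    (f : MvPolynomial (Fin n) ℝ)
    (hf : f = MvPolynomial.C a * (∏ k, L k ^ (2 * j k - 1)) * ∏ s, H s ^ (2 * i s))
    (hfnonconst : f.totalDegree ≠ 0) :
    (∀ x : Fin n → ℝ, 0 ≤ MvPolynomial.eval x f) ↔
      (∀ k, ∀ x : Fin n → ℝ, 0 ≤ MvPolynomial.eval x (L k)) := by
  constructor
  · intro hnn k
    set g : MvPolynomial (Fin n) ℝ := MvPolynomial.C a *
      (∏ k' ∈ Finset.univ.erase k, L k' ^ (2 * j k' - 1)) * ∏ s, H s ^ (2 * i s) with hg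
    have hprime : Prime (L k) := (hLirr k).prime
    have hndvd : ¬ L k ∣ g := by
      intro hd
      rcases hprime.dvd_or_dvd hd with hd | hd
      · rcases hprime.dvd_or_dvd hd with hd | hd
        · exact (hLirr k).not_isUnit
            (isUnit_of_dvd_unit hd ((isUnit_iff_ne_zero.mpr ha.ne').map MvPolynomial.C))
        · obtain ⟨k', hk', hd⟩ := (Prime.dvd_finset_prod_iff hprime _).mp hd
          have hd := hprime.dvd_of_dvd_pow hd
          have := lexMonic_assoc (hLmonic k) (hLmonic k')
            ((hLirr k).associated_of_dvd (hLirr k') hd)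
          exact (Finset.ne_of_mem_erase hk') (hLinj this).symm
      · obtain ⟨s, -, hd⟩ := (Prime.dvd_finset_prod_iff hprime _).mp hd
        have hd := hprime.dvd_of_dvd_pow hd
        exact hLH k s (lexMonic_assoc (hLmonic k) (hHmonic s)
            ((hLirr k).associated_of_dvd (hHirr s) hd))
    have hfg : f = (L k ^ (j k - 1)) ^ 2 * (L k * g) := by
      rw [hf, ← Finset.mul_prod_erase Finset.univ _ (Finset.mem_univ k), hg]
      have : 2 * j k - 1 = (j k - 1) * 2 + 1 := by have := hj k; omega
      rw [this, pow_succ, pow_mul]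
      ring
    have hpos : ∀ x, 0 ≤ MvPolynomial.eval x (L k) * MvPolynomial.eval x g := by
      intro x
      have h1 := hnn x
      rw [hfg] at h1
      simp only [map_mul, map_pow] at h1
      by_cases h0 : MvPolynomial.eval x (L k) = 0
      · rw [h0, zero_mul]
      · exact nonneg_of_mul_nonneg_right h1 (by positivity)
    obtain ⟨b, hb⟩ := lexMonic_pos (hLmonic k)
    intro x
    by_contra hx
    exact sign_main (L k) g (hLirr k) hndvd hpos x b (not_le.mp hx) hb
  · intro h x
    rw [hf]
    simp only [map_mul, map_prod, map_pow, MvPolynomial.eval_C]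
    refine mul_nonneg (mul_nonneg ha.le (Finset.prod_nonneg fun k _ => pow_nonneg (h k x) _))
      (Finset.prod_nonneg fun s _ => ?_)
    rw [pow_mul]
    positivity
end

section
/- Let f ∈ ℝ[x₁,…,xₙ] be a nonzero squarefree polynomial and U ⊆ ℝⁿ a connected open set on which f is semi-definite (i.e., f ≥ 0 throughout U, or f ≤ 0 throughout U). Then U \ Zero(f) is a connected open set. -/
open MvPolynomial

section Algebra
open Polynomial IsLocalization nonZeroDivisors

/-- A squarefree polynomial over a GCD domain stays squarefree over the fraction field. -/
theorem aux_squarefree_map {R : Type*} [CommRing R] [IsDomain R] [NormalizedGCDMonoid R]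
    (P : R[X]) (hP : Squarefree P) :
    Squarefree (P.map (algebraMap R (FractionRing R))) := by
  intro g hg
  have hP0 : P ≠ 0 := hP.ne_zero
  have hPm : P.map (algebraMap R (FractionRing R)) ≠ 0 := by
    rw [Ne, Polynomial.map_eq_zero_iff (IsFractionRing.injective R (FractionRing R))]
    exact hP0
  have hg0 : g ≠ 0 := by
    rintro rfl
    rw [mul_zero, zero_dvd_iff] at hg
    exact hPm hg
  set h := (integerNormalization R⁰ g).primPart with hh
  have hprim : h.IsPrimitive := isPrimitive_primPart _
  have hdvd : h.map (algebraMap R (FractionRing R)) ∣ g := by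
    obtain ⟨c, c0, hc⟩ := integerNormalization_spec R⁰ g
    have h1 : h.map (algebraMap R (FractionRing R)) ∣ c • g := by
      rw [← hc]
      exact Polynomial.map_dvd _ (primPart_dvd _)
    rw [Algebra.smul_def, Polynomial.algebraMap_apply] at h1
    have hu : IsUnit (Polynomial.C (algebraMap R (FractionRing R) c)) := by
      rw [Polynomial.isUnit_C]
      exact IsLocalization.map_units (FractionRing R) (⟨c, c0⟩ : R⁰)
    exact (hu.dvd_mul_left).1 h1
  have h2 : h * h ∣ P := by
    apply (hprim.mul hprim).dvd_of_fraction_map_dvd_fraction_map (K := FractionRing R)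
    rw [Polynomial.map_mul]
    exact (mul_dvd_mul hdvd hdvd).trans hg
  exact isUnit_or_eq_zero_of_isUnit_integerNormalization_primPart hg0 (hP h h2)

theorem aux_bezout {R : Type*} [CommRing R] [IsDomain R] [NormalizedGCDMonoid R] [CharZero R]
    (P : R[X]) (hP : Squarefree P) :
    ∃ (A B : R[X]) (r : R), r ≠ 0 ∧ A * P + B * derivative P = Polynomial.C r := by
  have hs := aux_squarefree_map P hP
  have : CharZero (FractionRing R) :=
    charZero_of_injective_algebraMap (IsFractionRing.injective R (FractionRing R))
  obtain ⟨a, b, hab⟩ := PerfectField.separable_iff_squarefree.2 hs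
  obtain ⟨c, c0, hc⟩ := integerNormalization_spec R⁰ a
  obtain ⟨d, d0, hd⟩ := integerNormalization_spec R⁰ b
  refine ⟨Polynomial.C d * integerNormalization R⁰ a, Polynomial.C c * integerNormalization R⁰ b, c * d,
    mul_ne_zero (nonZeroDivisors.ne_zero c0) (nonZeroDivisors.ne_zero d0), ?_⟩
  apply Polynomial.map_injective _ (IsFractionRing.injective R (FractionRing R))
  rw [Algebra.smul_def, Polynomial.algebraMap_apply] at hc hd
  simp only [Polynomial.map_add, Polynomial.map_mul, hc, hd, Polynomial.map_C, map_mul]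
  rw [Polynomial.derivative_map] at hab
  linear_combination (Polynomial.C (algebraMap R (FractionRing R) c) * Polynomial.C (algebraMap R (FractionRing R) d)) * hab

end Algebra

/-- For each coordinate direction there is a nonzero polynomial not depending on that coordinate
which vanishes on the local extremum zeros of `f`. -/
theorem aux_elim {n : ℕ} (f : MvPolynomial (Fin n) ℝ) (hsf : Squarefree f) (i : Fin n) :
    ∃ r : MvPolynomial (Fin n) ℝ, r ≠ 0 ∧
      (∀ x t, eval (Function.update x i t) r = eval x r) ∧
      ∀ x, eval x f = 0 → IsLocalExtr (fun y => eval y f) x → eval x r = 0 := by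
  classical
  let S := {j : Fin n // j ≠ i}
  let σ : Option S ≃ Fin n := Equiv.optionSubtypeNe i
  let e : MvPolynomial (Fin n) ℝ ≃ₐ[ℝ] Polynomial (MvPolynomial S ℝ) :=
    (renameEquiv ℝ σ.symm).trans (optionEquivLeft ℝ S)
  have hev : ∀ (g : MvPolynomial (Fin n) ℝ) (x : Fin n → ℝ) (t : ℝ),
      Polynomial.eval t ((e g).map (eval fun j : S => x j)) = eval (Function.update x i t) g := by
    intro g x t
    change Polynomial.eval t (((optionEquivLeft ℝ S) (rename σ.symm g)).map _) = _
    rw [← optionEquivLeft_elim_eval, eval_rename]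
    congr 1
    congr 1
    ext j
    obtain ⟨o, rfl⟩ := σ.surjective j
    cases o with
    | none =>
      have h : σ none = i := rfl
      have hs2 : σ.symm i = none := by rw [← h, Equiv.symm_apply_apply]
      simp only [Function.comp_apply, h, hs2, Option.elim_none, Function.update_self]
    | some k =>
      have h : σ (some k) = k.1 := rfl
      have hs2 : σ.symm k.1 = some k := by rw [← h, Equiv.symm_apply_apply]
      simp only [Function.comp_apply, h, hs2, Option.elim_some, Function.update_of_ne k.2]
  let _ : NormalizedGCDMonoid (MvPolynomial S ℝ) := Nonempty.some inferInstance
  have hsq : Squarefree (e f) := by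
    intro g hg
    have h1 : e.symm g * e.symm g ∣ f := by
      have := map_dvd e.symm hg
      simpa using this
    have h2 := (hsf _ h1).map e
    simpa using h2
  obtain ⟨A, B, r, hr0, hr⟩ := aux_bezout (e f) hsq
  refine ⟨e.symm (Polynomial.C r), ?_, ?_, ?_⟩
  · simpa using hr0
  · intro x t
    have h1 := hev (e.symm (Polynomial.C r)) x t
    have h2 := hev (e.symm (Polynomial.C r)) x (x i)
    simp only [AlgEquiv.apply_symm_apply, Polynomial.map_C, Polynomial.eval_C,
      Function.update_eq_self] at h1 h2
    rw [← h1, ← h2]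
  · intro x hx hext
    set Q := (e f).map (eval fun j : S => x j) with hQ
    have hQ0 : Q.eval (x i) = 0 := by
      rw [hQ, hev, Function.update_eq_self, hx]
    have hQ1 : Q.derivative.eval (x i) = 0 := by
      have hl : IsLocalExtr (fun t => Q.eval t) (x i) := by
        have h3 : (fun t => Q.eval t) = (fun y => eval y f) ∘ (fun t => Function.update x i t) := by
          ext t
          exact hev f x t
        rw [h3]
        apply IsExtrFilter.comp_tendsto (l := nhds x)
        · rw [Function.update_eq_self]
          exact hext
        · have : ContinuousAt (fun t => Function.update x i t) (x i) := by fun_prop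
          simpa [ContinuousAt] using this
      exact hl.hasDerivAt_eq_zero (Q.hasDerivAt (x i))
    have h4 := congrArg (fun p => Polynomial.eval (x i) (p.map (eval fun j : S => x j))) hr
    simp only [Polynomial.map_add, Polynomial.map_mul, Polynomial.eval_add, Polynomial.eval_mul,
      ← Polynomial.derivative_map, ← hQ, hQ0, hQ1, mul_zero, add_zero] at h4
    have h2 := hev (e.symm (Polynomial.C r)) x (x i)
    simp only [AlgEquiv.apply_symm_apply, Function.update_eq_self] at h2
    rw [← h2, ← h4]

theorem aux_dense {n : ℕ} (r : MvPolynomial (Fin n) ℝ) (hr : r ≠ 0) :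
    Dense {x | eval x r ≠ 0} := by
  intro a
  rw [Metric.mem_closure_iff]
  intro ε hε
  by_contra hcon
  push Not at hcon
  apply hr
  apply funext_set (fun i => Metric.ball (a i) ε)
  · intro i
    rw [Real.ball_eq_Ioo]
    exact Set.Ioo_infinite (by linarith)
  · intro x hx
    by_contra hne
    have h1 := hcon x (by simpa using hne)
    rw [← ball_pi _ hε, Metric.mem_ball, dist_comm] at hx
    linarith

theorem aux_closure {n : ℕ} (f : MvPolynomial (Fin n) ℝ)
    (U A C : Set (Fin n → ℝ)) (hUopen : IsOpen U) (hUconn : IsConnected U)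
    (hr : ∀ i, ∃ r : MvPolynomial (Fin n) ℝ, r ≠ 0 ∧
      (∀ x t, eval (Function.update x i t) r = eval x r) ∧
      ∀ x ∈ U, eval x f = 0 → eval x r = 0)
    (hA : IsOpen A) (hC : IsOpen C) (hAU : A ⊆ U) (hne : A.Nonempty) (hdisj : Disjoint A C)
    (hcov : U \ {a | eval a f = 0} ⊆ A ∪ C) : U ⊆ closure A := by
  have hball : ∀ a ∈ U, a ∈ closure A → ∃ ε > 0, Metric.ball a ε ⊆ closure A := by
    intro a haU haA
    obtain ⟨ε, hε, hεU⟩ := Metric.isOpen_iff.1 hUopen a haU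
    refine ⟨ε, hε, fun b hb => ?_⟩
    have hmem : ∀ x, x ∈ Metric.ball a ε ↔ ∀ j, x j ∈ Metric.ball (a j) ε := by
      intro x
      rw [ball_pi _ hε]
      simp
    have key : ∀ s : Finset (Fin n), s.piecewise b a ∈ closure A ∧
        s.piecewise b a ∈ Metric.ball a ε := by
      intro s
      induction s using Finset.induction_on with
      | empty => simpa using ⟨haA, hε⟩
      | insert i s his ih =>
        obtain ⟨ih1, ih2⟩ := ih
        rw [Finset.piecewise_insert]
        set x := s.piecewise b a
        refine ⟨?_, ?_⟩
        · obtain ⟨r, hr0, hrup, hrz⟩ := hr i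
          have hx : x ∈ closure ((A ∩ Metric.ball a ε) ∩ {x | eval x r ≠ 0}) := by
            rw [mem_closure_iff]
            intro o ho hxo
            obtain ⟨z, ⟨hzo, hzb⟩, hzA⟩ := mem_closure_iff.1 ih1 _
              (ho.inter Metric.isOpen_ball) ⟨hxo, ih2⟩
            obtain ⟨w, ⟨⟨hwo, hwb⟩, hwA⟩, hwr⟩ := (aux_dense r hr0).inter_open_nonempty _
              ((ho.inter Metric.isOpen_ball).inter hA) ⟨z, ⟨hzo, hzb⟩, hzA⟩
            exact ⟨w, hwo, ⟨hwA, hwb⟩, hwr⟩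
          refine map_mem_closure (f := fun y => Function.update y i (b i)) (by fun_prop) hx ?_
          rintro y ⟨⟨hyA, hyb⟩, hyr⟩
          have hL : IsPreconnected (Set.image (fun t => Function.update y i t) (Metric.ball (a i) ε)) := by
            apply IsPreconnected.image
            · exact (convex_ball _ _).isPreconnected
            · exact Continuous.continuousOn (by fun_prop)
          have hsub : Set.image (fun t => Function.update y i t) (Metric.ball (a i) ε) ⊆ A ∪ C := by
            rintro _ ⟨t, ht, rfl⟩
            apply hcov
            have hU : Function.update y i t ∈ U := by
              apply hεU
              rw [hmem]
              intro j
              by_cases hj : j = i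
              · subst hj
                simpa using ht
              · simpa [hj] using (hmem y).1 hyb j
            refine ⟨hU, fun h0 => hyr ?_⟩
            rw [← hrup y t]
            exact hrz _ hU h0
          refine hL.subset_left_of_subset_union hA hC hdisj hsub ?_ ⟨b i, (hmem b).1 hb i, rfl⟩
          exact ⟨y, ⟨y i, (hmem y).1 hyb i, by simp⟩, hyA⟩
        · rw [hmem]
          intro j
          by_cases hj : j = i
          · subst hj
            simpa using (hmem b).1 hb j
          · simpa [hj] using (hmem x).1 ih2 j
    simpa using (key Finset.univ).1
  have hpre := hUconn.isPreconnected
  refine (hpre.subset_of_closure_inter_subset (u := interior (closure A)) isOpen_interior ?_ ?_).trans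
    interior_subset
  · obtain ⟨a, ha⟩ := hne
    exact ⟨a, hAU ha, interior_maximal subset_closure hA ha⟩
  · rintro x ⟨hx, hxU⟩
    have hx2 : x ∈ closure A := closure_minimal interior_subset isClosed_closure hx
    obtain ⟨ε, hε, h⟩ := hball x hxU hx2
    exact mem_interior.2 ⟨_, h, Metric.isOpen_ball, Metric.mem_ball_self hε⟩

theorem stmt_11 (n : ℕ) (f : MvPolynomial (Fin n) ℝ) (hf : f ≠ 0) (hsf : Squarefree f)
    (U : Set (Fin n → ℝ)) (hUopen : IsOpen U) (hUconn : IsConnected U)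
    (hsemi : (∀ a ∈ U, 0 ≤ MvPolynomial.eval a f) ∨ (∀ a ∈ U, MvPolynomial.eval a f ≤ 0)) :
    IsOpen (U \ {a | MvPolynomial.eval a f = 0}) ∧
    IsConnected (U \ {a | MvPolynomial.eval a f = 0}) := by
  have hopen : IsOpen (U \ {a | MvPolynomial.eval a f = 0}) :=
    hUopen.sdiff (isClosed_eq (MvPolynomial.continuous_eval f) continuous_const)
  have hr : ∀ i, ∃ r : MvPolynomial (Fin n) ℝ, r ≠ 0 ∧
      (∀ x t, eval (Function.update x i t) r = eval x r) ∧
      ∀ x ∈ U, eval x f = 0 → eval x r = 0 := by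
    intro i
    obtain ⟨r, h1, h2, h3⟩ := aux_elim f hsf i
    refine ⟨r, h1, h2, fun x hx hx0 => h3 x hx0 ?_⟩
    rcases hsemi with h | h
    · left
      filter_upwards [hUopen.mem_nhds hx] with y hy
      rw [hx0]
      exact h y hy
    · right
      filter_upwards [hUopen.mem_nhds hx] with y hy
      rw [hx0]
      exact h y hy
  refine ⟨hopen, ?_, ?_⟩
  · obtain ⟨x, hxU, hx⟩ := (aux_dense f hf).inter_open_nonempty U hUopen hUconn.nonempty
    exact ⟨x, hxU, hx⟩
  · intro u v hu hv hcov hnu hnv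
    by_contra hcon
    set s := U \ {a | MvPolynomial.eval a f = 0} with hs
    have hdisj : Disjoint (s ∩ u) (s ∩ v) := by
      rw [Set.disjoint_left]
      rintro x ⟨hxs, hxu⟩ ⟨_, hxv⟩
      exact hcon ⟨x, hxs, hxu, hxv⟩
    have hcl := aux_closure f U (s ∩ u) (s ∩ v) hUopen hUconn hr (hopen.inter hu) (hopen.inter hv)
      (fun x hx => hx.1.1) hnu hdisj (by
        intro x hx
        rcases hcov hx with h | h
        · exact Or.inl ⟨hx, h⟩
        · exact Or.inr ⟨hx, h⟩)
    obtain ⟨y, hy⟩ := hnv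
    obtain ⟨z, hz1, hz2⟩ := mem_closure_iff.1 (hcl hy.1.1) _ (hopen.inter hv) hy
    exact Set.disjoint_left.1 hdisj hz2 hz1
end
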